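/- Let 0 < c < 1, let V = [−c, c] regarded as a subset of 𝕋 = ℝ/2πℤ with λ(V) = c/π for the normalized Haar measure λ, let f(s) = e^{is} − 1, and let v = f·((1/λ(V))·(1_{V+V} ∗ 1_V)). Then v ∈ A(𝕋), ‖v‖_{A(𝕋)} ≤ 2√2, v(x) = f(x) for all x ∈ V, and supp v ⊆ V + V + V = [−3c, 3c]. -/

import Mathlib

open MeasureTheory AddCircle

noncomputable section

local instance : Fact (0 < 2 * Real.pi) := ⟨by positivity⟩

/-- The circle `𝕋 = ℝ/2πℤ`. -/
abbrev Circle2Pi : Type := AddCircle (2 * Real.pi)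

/-- Membership in the Fourier algebra `A(𝕋)`: continuity together with absolute
summability of the Fourier coefficients. -/
def MemFourierAlg (f : Circle2Pi → ℂ) : Prop :=
  Continuous f ∧ Summable fun n : ℤ => ‖fourierCoeff f n‖

/-- The norm of the Fourier algebra `A(𝕋)`: `‖f‖ = ∑ₙ |f̂(n)|`. -/
def fourierAlgNorm (f : Circle2Pi → ℂ) : ℝ :=
  ∑' n : ℤ, ‖fourierCoeff f n‖

/-- Normalized convolution on `𝕋` (with respect to the probability Haar measure). -/
def circleConv (f g : Circle2Pi → ℂ) : Circle2Pi → ℂ :=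
  fun x => ∫ y : Circle2Pi, f y * g (x - y) ∂haarAddCircle


open scoped Pointwise

theorem aux_ball (r : ℝ) (hr : r ≤ Real.pi) :
    (fun x : ℝ => (x : Circle2Pi)) '' Set.Icc (-r) r = Metric.closedBall (0 : Circle2Pi) r := by
  have hp : (2 * Real.pi) ≠ 0 := by positivity
  have hpi := Real.pi_pos
  have hab : |2 * Real.pi| = 2 * Real.pi := abs_of_pos (by positivity)
  ext y
  simp only [Set.mem_image, mem_closedBall_zero_iff]
  constructor
  · rintro ⟨x, hx, rfl⟩
    have h1 : |x| ≤ r := abs_le.2 hx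
    rw [(AddCircle.norm_coe_eq_abs_iff (2 * Real.pi) hp).2 (by rw [hab]; linarith)]
    exact h1
  · intro hy
    obtain ⟨x, hx, rfl⟩ : ∃ x ∈ Set.Ioc (-Real.pi) (-Real.pi + 2 * Real.pi),
        (x : Circle2Pi) = y := by
      have := AddCircle.coe_image_Ioc_eq (2 * Real.pi) (-Real.pi)
      have h2 : y ∈ (Set.univ : Set Circle2Pi) := trivial
      rw [← this] at h2
      exact h2
    refine ⟨x, ?_, rfl⟩
    have h3 : |x| ≤ Real.pi := abs_le.2 ⟨hx.1.le, by linarith [hx.2]⟩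
    rw [(AddCircle.norm_coe_eq_abs_iff (2 * Real.pi) hp).2 (by rw [hab]; linarith)] at hy
    exact abs_le.1 hy

theorem aux_add (a b : ℝ) (ha : 0 < a) (hb : 0 < b) :
    (fun x : ℝ => (x : Circle2Pi)) '' Set.Icc (-a) a +
      (fun x : ℝ => (x : Circle2Pi)) '' Set.Icc (-b) b =
    (fun x : ℝ => (x : Circle2Pi)) '' Set.Icc (-(a + b)) (a + b) := by
  ext y
  constructor
  · rintro ⟨_, ⟨s, hs, rfl⟩, _, ⟨t, ht, rfl⟩, rfl⟩
    exact ⟨s + t, ⟨by linarith [hs.1, ht.1], by linarith [hs.2, ht.2]⟩, by simp⟩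
  · rintro ⟨x, hx, rfl⟩
    have hab : 0 < a + b := by linarith
    refine ⟨_, ⟨x * (a / (a + b)), ?_, rfl⟩, _, ⟨x * (b / (a + b)), ?_, rfl⟩, ?_⟩
    · have h1 : 0 ≤ a / (a + b) := by positivity
      have h2 : (a + b) * (a / (a + b)) = a := by field_simp
      exact ⟨by nlinarith [hx.1], by nlinarith [hx.2]⟩
    · have h1 : 0 ≤ b / (a + b) := by positivity
      have h2 : (a + b) * (b / (a + b)) = b := by field_simp
      exact ⟨by nlinarith [hx.1], by nlinarith [hx.2]⟩
    · have : x = x * (a / (a + b)) + x * (b / (a + b)) := by field_simp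
      conv_rhs => rw [this]
      simp

theorem aux_meas (r : ℝ) (hr : r ≤ Real.pi) :
    haarAddCircle (Metric.closedBall (0 : Circle2Pi) r) = ENNReal.ofReal (r / Real.pi) := by
  have h := AddCircle.volume_closedBall (T := 2 * Real.pi) (x := 0) r
  have hpi := Real.pi_pos
  rw [min_eq_right (by linarith), volume_eq_smul_haarAddCircle, Measure.smul_apply,
    smul_eq_mul] at h
  have h2 : ENNReal.ofReal (2 * r) =
      ENNReal.ofReal (2 * Real.pi) * ENNReal.ofReal (r / Real.pi) := by
    rw [← ENNReal.ofReal_mul (by positivity)]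
    congr 1
    field_simp
  rw [h2] at h
  exact (ENNReal.mul_right_inj (by simp [hpi]) ENNReal.ofReal_ne_top).1 h

theorem aux_parseval (S : Set Circle2Pi) (hS : MeasurableSet S) :
    HasSum (fun n : ℤ => ‖fourierCoeff (S.indicator fun _ => (1 : ℂ)) n‖ ^ 2)
      (haarAddCircle.real S) := by
  have hm : MemLp (S.indicator fun _ => (1 : ℂ)) 2 (haarAddCircle (T := 2 * Real.pi)) :=
    (memLp_const (1 : ℂ)).indicator hS
  have h := hasSum_sq_fourierCoeff (hm.toLp _)
  rw [fourierCoeff_congr_ae hm.coeFn_toLp] at h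
  convert h using 1
  have : ∫ t, ‖(hm.toLp _) t‖ ^ 2 ∂(haarAddCircle (T := 2 * Real.pi)) =
      ∫ t, S.indicator (fun _ => (1 : ℝ)) t ∂haarAddCircle := by
    apply integral_congr_ae
    filter_upwards [hm.coeFn_toLp] with t ht
    rw [ht]
    by_cases h : t ∈ S <;> simp [h]
  rw [this, integral_indicator hS]
  simp

theorem aux_coeff (S W : Set Circle2Pi) (hS : MeasurableSet S) (hW : MeasurableSet W) (n : ℤ) :
    fourierCoeff (circleConv (S.indicator fun _ => (1 : ℂ)) (W.indicator fun _ => (1 : ℂ))) n =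
      fourierCoeff (S.indicator fun _ => (1 : ℂ)) n *
      fourierCoeff (W.indicator fun _ => (1 : ℂ)) n := by
  set u : Circle2Pi → ℂ := S.indicator fun _ => (1 : ℂ) with hu
  set w : Circle2Pi → ℂ := W.indicator fun _ => (1 : ℂ) with hw
  have hum : Measurable u := measurable_const.indicator hS
  have hwm : Measurable w := measurable_const.indicator hW
  have hub : ∀ x, ‖u x‖ ≤ 1 := fun x => by
    by_cases h : x ∈ S <;> simp [hu, h]
  have hwb : ∀ x, ‖w x‖ ≤ 1 := fun x => by
    by_cases h : x ∈ W <;> simp [hw, h]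
  simp only [fourierCoeff, circleConv, smul_eq_mul]
  simp_rw [← integral_const_mul]
  rw [integral_integral_swap]
  · rw [integral_const_mul, ← integral_mul_const]
    congr 1
    ext y
    rw [← integral_sub_right_eq_self (fun a => (fourier (-n) a : ℂ) * w a) y, ← integral_const_mul]
    congr 1
    ext x
    have : (fourier (-n) x : ℂ) = fourier (-n) y * fourier (-n) (x - y) := by
      rw [fourier_apply, fourier_apply, fourier_apply, ← Circle.coe_mul, ← toCircle_add,
        ← smul_add]
      simp
    rw [this]
    ring
  · refine Integrable.of_bound (C := 1) ?_ (Filter.Eventually.of_forall ?_)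
    · apply Measurable.aestronglyMeasurable
      have hf : Measurable (fun x : Circle2Pi => (fourier (-n) x : ℂ)) :=
        (map_continuous (fourier (-n))).measurable
      exact (hf.comp measurable_fst).mul ((hum.comp measurable_snd).mul
        (hwm.comp (measurable_fst.sub measurable_snd)))
    · rintro ⟨x, y⟩
      simp only [Function.uncurry, norm_mul]
      rw [fourier_apply, Circle.norm_coe, one_mul]
      exact mul_le_one₀ (hub _) (norm_nonneg _) (hwb _)

theorem aux_cont (S : Set Circle2Pi) (hS : MeasurableSet S) (c : ℝ) :
    Continuous (circleConv (S.indicator fun _ => (1 : ℂ))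
      ((Metric.closedBall (0 : Circle2Pi) c).indicator fun _ => (1 : ℂ))) := by
  set u : Circle2Pi → ℂ := S.indicator fun _ => (1 : ℂ) with hu
  set W := Metric.closedBall (0 : Circle2Pi) c with hWdef
  set w : Circle2Pi → ℂ := W.indicator fun _ => (1 : ℂ) with hw
  have hum : Measurable u := measurable_const.indicator hS
  have hwm : Measurable w := measurable_const.indicator Metric.isClosed_closedBall.measurableSet
  have hub : ∀ x, ‖u x‖ ≤ 1 := fun x => by
    by_cases h : x ∈ S <;> simp [hu, h]
  have hwb : ∀ x, ‖w x‖ ≤ 1 := fun x => by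
    by_cases h : x ∈ W <;> simp [hw, h]
  rw [continuous_iff_continuousAt]
  intro x₀
  unfold circleConv
  refine continuousAt_of_dominated (bound := fun _ => 1) ?_ ?_ (integrable_const _) ?_
  · refine Filter.Eventually.of_forall fun x => Measurable.aestronglyMeasurable ?_
    exact hum.mul (hwm.comp (measurable_const.sub measurable_id))
  · refine Filter.Eventually.of_forall fun x => Filter.Eventually.of_forall fun y => ?_
    rw [norm_mul]
    exact mul_le_one₀ (hub _) (norm_nonneg _) (hwb _)
  · have hae : Metric.closedBall x₀ c =ᵐ[haarAddCircle] Metric.ball x₀ c := by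
      have := AddCircle.closedBall_ae_eq_ball (T := 2 * Real.pi) (x := x₀) (ε := c)
      rw [volume_eq_smul_haarAddCircle] at this
      exact (Measure.ae_ennreal_smul_measure_iff (by simp [Real.pi_pos])).1 this
    filter_upwards [hae] with y hy
    have hy' : dist y x₀ ≤ c ↔ dist y x₀ < c := by
      have := hy
      exact iff_of_eq this
    refine continuousAt_const.mul ?_
    have hsub : ContinuousAt (fun x : Circle2Pi => ‖x - y‖) x₀ := by fun_prop
    have hd : ‖x₀ - y‖ = dist y x₀ := by rw [dist_comm, dist_eq_norm]
    by_cases h : dist y x₀ < c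
    · have : ∀ᶠ x in nhds x₀, ‖x - y‖ < c := hsub.eventually_lt continuousAt_const (by rw [hd]; exact h)
      refine (continuousAt_const (y := (1 : ℂ))).congr ?_
      filter_upwards [this] with x hx
      simp [hw, hWdef, hx.le]
    · have h2 : c < dist y x₀ := not_le.1 fun h' => h (hy'.1 h')
      have : ∀ᶠ x in nhds x₀, c < ‖x - y‖ :=
        continuousAt_const.eventually_lt hsub (by rw [hd]; exact h2)
      refine (continuousAt_const (y := (0 : ℂ))).congr ?_
      filter_upwards [this] with x hx
      simp [hw, hWdef, hx]

theorem stmt_15 (c : ℝ) (hc0 : 0 < c) (hc1 : c < 1)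
    (V : Set Circle2Pi) (hV : V = (fun x : ℝ => (x : Circle2Pi)) '' Set.Icc (-c) c)
    (f : Circle2Pi → ℂ) (hf : ∀ s : Circle2Pi, f s = fourier 1 s - 1)
    (v : Circle2Pi → ℂ)
    (hv : v = fun x => f x * (((Real.pi / c : ℝ) : ℂ) *
      circleConv ((V + V).indicator fun _ => (1 : ℂ)) (V.indicator fun _ => (1 : ℂ)) x)) :
    haarAddCircle V = ENNReal.ofReal (c / Real.pi) ∧
    MemFourierAlg v ∧
    fourierAlgNorm v ≤ 2 * Real.sqrt 2 ∧
    (∀ x ∈ V, v x = f x) ∧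
    tsupport v ⊆ V + V + V ∧
    V + V + V = (fun x : ℝ => (x : Circle2Pi)) '' Set.Icc (-(3 * c)) (3 * c) := by
  have hpi := Real.pi_gt_three
  have hVb : V = Metric.closedBall 0 c := by rw [hV]; exact aux_ball c (by linarith)
  have hVV : V + V = (fun x : ℝ => (x : Circle2Pi)) '' Set.Icc (-(2 * c)) (2 * c) := by
    rw [hV, aux_add c c hc0 hc0]; ring_nf
  have hVVb : V + V = Metric.closedBall 0 (2 * c) := by
    rw [hVV]; exact aux_ball _ (by linarith)
  have hVVV : V + V + V = (fun x : ℝ => (x : Circle2Pi)) '' Set.Icc (-(3 * c)) (3 * c) := by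
    rw [hVV, hV, aux_add _ c (by linarith) hc0]; ring_nf
  have hVVVb : V + V + V = Metric.closedBall 0 (3 * c) := by
    rw [hVVV]; exact aux_ball _ (by linarith)
  have hVm : MeasurableSet V := by rw [hVb]; exact Metric.isClosed_closedBall.measurableSet
  have hVVm : MeasurableSet (V + V) := by
    rw [hVVb]; exact Metric.isClosed_closedBall.measurableSet
  have hμ : haarAddCircle V = ENNReal.ofReal (c / Real.pi) := by
    rw [hVb]; exact aux_meas c (by linarith)
  have hμr : haarAddCircle.real V = c / Real.pi := by
    rw [Measure.real, hμ, ENNReal.toReal_ofReal (by positivity)]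
  have hμ2r : haarAddCircle.real (V + V) = 2 * c / Real.pi := by
    rw [Measure.real, hVVb, aux_meas (2 * c) (by linarith), ENNReal.toReal_ofReal (by positivity)]
  set u : Circle2Pi → ℂ := (V + V).indicator fun _ => (1 : ℂ) with hu
  set w : Circle2Pi → ℂ := V.indicator fun _ => (1 : ℂ) with hw
  have hgc : Continuous (circleConv u w) := by
    rw [hw, hVb]; exact aux_cont _ hVVm c
  have hfc : Continuous f := by
    rw [funext hf]; fun_prop
  have hvc : Continuous v := by
    rw [hv]; exact hfc.mul (continuous_const.mul hgc)
  have hs1 := aux_parseval _ hVVm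
  have hs2 := aux_parseval _ hVm
  rw [← hu, hμ2r] at hs1
  rw [← hw, hμr] at hs2
  have h2 : 0 < Real.sqrt 2 := by positivity
  have h22 : Real.sqrt 2 * Real.sqrt 2 = 2 := Real.mul_self_sqrt (by norm_num)
  have hS := (hs1.mul_left (Real.sqrt 2 / 4)).add (hs2.mul_left (Real.sqrt 2 / 2))
  set A : ℤ → ℝ := fun n => ‖fourierCoeff (circleConv u w) n‖ with hA
  have hAle : ∀ n, A n ≤ Real.sqrt 2 / 4 * ‖fourierCoeff u n‖ ^ 2 +
      Real.sqrt 2 / 2 * ‖fourierCoeff w n‖ ^ 2 := by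
    intro n
    have : A n = ‖fourierCoeff u n‖ * ‖fourierCoeff w n‖ := by
      rw [hA, ← norm_mul, ← aux_coeff _ _ hVVm hVm]
    rw [this]
    have := mul_nonneg h2.le (sq_nonneg (‖fourierCoeff u n‖ - Real.sqrt 2 * ‖fourierCoeff w n‖))
    have e : Real.sqrt 2 * (‖fourierCoeff u n‖ - Real.sqrt 2 * ‖fourierCoeff w n‖) ^ 2 =
        Real.sqrt 2 * ‖fourierCoeff u n‖ ^ 2
        - 2 * (Real.sqrt 2 * Real.sqrt 2) * (‖fourierCoeff u n‖ * ‖fourierCoeff w n‖)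
        + Real.sqrt 2 * (Real.sqrt 2 * Real.sqrt 2) * ‖fourierCoeff w n‖ ^ 2 := by ring
    rw [e, h22] at this
    linarith
  have hAs : Summable A := Summable.of_nonneg_of_le (fun _ => norm_nonneg _) hAle hS.summable
  have hAt : ∑' n, A n ≤ Real.sqrt 2 * (c / Real.pi) := by
    refine (hAs.tsum_le_tsum hAle hS.summable).trans ?_
    rw [hS.tsum_eq]
    apply le_of_eq; ring
  have hcoef : ∀ n, fourierCoeff v n = ((Real.pi / c : ℝ) : ℂ) *
      (fourierCoeff (circleConv u w) (n - 1) - fourierCoeff (circleConv u w) n) := by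
    intro n
    have hi : Integrable (circleConv u w) haarAddCircle :=
      hgc.integrable_of_hasCompactSupport (HasCompactSupport.of_compactSpace _)
    simp only [fourierCoeff]
    rw [← integral_sub (hi.fourier_smul _) (hi.fourier_smul _), ← integral_const_mul]
    congr 1
    ext x
    have : (fourier (-(n - 1)) x : ℂ) = fourier (-n) x * fourier 1 x := by
      rw [← fourier_add]; congr 2; ring
    simp only [hv, hf, smul_eq_mul]
    rw [this]
    ring
  have hvle : ∀ n, ‖fourierCoeff v n‖ ≤ Real.pi / c * (A (n - 1) + A n) := by
    intro n
    rw [hcoef, norm_mul, Complex.norm_real, Real.norm_of_nonneg (by positivity)]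
    gcongr
    exact norm_sub_le _ _
  have hAs' : Summable fun n => A (n - 1) := (Equiv.subRight (1 : ℤ)).summable_iff.2 hAs
  have hAt' : ∑' n, A (n - 1) = ∑' n, A n := (Equiv.subRight (1 : ℤ)).tsum_eq A
  have hBs : Summable fun n => Real.pi / c * (A (n - 1) + A n) := (hAs'.add hAs).mul_left _
  have hvs : Summable fun n => ‖fourierCoeff v n‖ :=
    Summable.of_nonneg_of_le (fun _ => norm_nonneg _) hvle hBs
  refine ⟨hμ, ⟨hvc, hvs⟩, ?_, ?_, ?_, hVVV⟩
  · refine (hvs.tsum_le_tsum hvle hBs).trans ?_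
    rw [tsum_mul_left, hAs'.tsum_add hAs, hAt']
    calc Real.pi / c * (∑' n, A n + ∑' n, A n)
        ≤ Real.pi / c * (Real.sqrt 2 * (c / Real.pi) + Real.sqrt 2 * (c / Real.pi)) := by gcongr
      _ = 2 * Real.sqrt 2 := by field_simp; ring
  · intro x hx
    have : circleConv u w x = ((c / Real.pi : ℝ) : ℂ) := by
      have h1 : ∀ y, u y * w (x - y) = w (x - y) := by
        intro y
        by_cases h : x - y ∈ V
        · have : y ∈ V + V := by
            refine ⟨x, hx, y - x, ?_, by simp⟩
            rw [hVb, mem_closedBall_zero_iff] at h ⊢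
            rwa [norm_sub_rev]
          simp [hu, this]
        · simp [hw, h]
      simp only [circleConv, h1]
      rw [integral_sub_left_eq_self w, hw, integral_indicator hVm]
      simp [hμr]
    rw [hv]
    simp only [this]
    rw [← Complex.ofReal_mul]
    have : Real.pi / c * (c / Real.pi) = 1 := by field_simp
    rw [this]; simp
  · refine closure_minimal ?_ (by rw [hVVVb]; exact Metric.isClosed_closedBall)
    intro x hx
    by_contra hn
    apply hx
    have h1 : ∀ y, u y * w (x - y) = 0 := by
      intro y
      by_cases h : y ∈ V + V
      · have : x - y ∉ V := fun h' => hn ⟨y, h, x - y, h', by simp⟩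
        simp [hw, this]
      · simp [hu, h]
    simp [hv, circleConv, h1]
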